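/- arXiv:0902.4495 — 3 statements merged into one kernel-verified Lean document; each statement's English description precedes it below -/
import Mathlib

section
/- Let P and Q be Feller Markov kernels on a Polish space X and let d be a continuous, [0,1]-valued distance-like function on X×X. Suppose d is contracting for P with constant α < 1, and suppose the lifted distance satisfies d(Q(x,·), Q(y,·)) ≤ d(x,y) for all x, y with d(x,y) < 1. Then d is contracting, with the same constant α, for the composition kernel R defined by R(x,·) = ∫ Q(z,·) P(x,dz) (one step of P followed by one step of Q): d(R(x,·), R(y,·)) ≤ α d(x,y) whenever d(x,y) < 1. -/
open MeasureTheory ProbabilityTheory Filter Topology BoundedContinuousFunction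
open scoped ENNReal NNReal

noncomputable section

/-- A coupling of two measures: a measure on the product with the given marginals. -/
def IsCoupling {α β : Type*} [MeasurableSpace α] [MeasurableSpace β]
    (π : Measure (α × β)) (μ : Measure α) (ν : Measure β) : Prop :=
  π.map Prod.fst = μ ∧ π.map Prod.snd = ν

/-- The lift of a distance-like function `d` to probability measures. -/
def liftDist {α : Type*} [MeasurableSpace α] (d : α → α → ℝ) (μ ν : Measure α) : ℝ≥0∞ :=
  sInf {r : ℝ≥0∞ | ∃ π : Measure (α × α), IsCoupling π μ ν ∧
    r = ∫⁻ p, ENNReal.ofReal (d p.1 p.2) ∂π}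

theorem IsCoupling.isProbabilityMeasure {α β : Type*} [MeasurableSpace α] [MeasurableSpace β]
    {π : Measure (α × β)} {μ : Measure α} {ν : Measure β} [IsProbabilityMeasure μ]
    (h : IsCoupling π μ ν) : IsProbabilityMeasure π := by
  have : IsProbabilityMeasure (π.map Prod.fst) := by rw [h.1]; infer_instance
  exact Measure.isProbabilityMeasure_of_map (f := Prod.fst)

theorem IsCoupling.liftDist_le {α : Type*} [MeasurableSpace α] {d : α → α → ℝ}
    {π : Measure (α × α)} {μ ν : Measure α} (h : IsCoupling π μ ν) :
    liftDist d μ ν ≤ ∫⁻ p, ENNReal.ofReal (d p.1 p.2) ∂π :=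
  sInf_le ⟨π, h, rfl⟩

/-- A weakly convergent sequence of probability measures on a Polish space is tight. -/
theorem isTightMeasureSet_range_of_tendsto {X : Type*}
    [TopologicalSpace X] [PolishSpace X] [MeasurableSpace X] [BorelSpace X]
    {m : ℕ → ProbabilityMeasure X} {l : ProbabilityMeasure X} (hm : Tendsto m atTop (𝓝 l)) :
    IsTightMeasureSet {((μ : ProbabilityMeasure X) : Measure X) | μ ∈ Set.range m} := by
  let := TopologicalSpace.upgradeIsCompletelyMetrizable X
  exact isTightMeasureSet_of_isCompact_closure
    (hm.isCompact_insert_range.closure_of_subset (Set.subset_insert _ _))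

/-- A sequence of probability measures on a product of Polish spaces whose marginals converge
weakly converges along some ultrafilter to a coupling of the limits of the marginals. -/
theorem exists_tendsto_ultrafilter_isCoupling {X Y : Type*}
    [TopologicalSpace X] [PolishSpace X] [MeasurableSpace X] [BorelSpace X]
    [TopologicalSpace Y] [PolishSpace Y] [MeasurableSpace Y] [BorelSpace Y]
    {Γ : ℕ → ProbabilityMeasure (X × Y)} {μ : ProbabilityMeasure X} {ν : ProbabilityMeasure Y}
    (hμ : Tendsto (fun n => (Γ n).map continuous_fst.measurable.aemeasurable) atTop (𝓝 μ))
    (hν : Tendsto (fun n => (Γ n).map continuous_snd.measurable.aemeasurable) atTop (𝓝 ν)) :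
    ∃ (U : Ultrafilter ℕ) (γ : ProbabilityMeasure (X × Y)), (U : Filter ℕ) ≤ atTop ∧
      Tendsto Γ U (𝓝 γ) ∧ IsCoupling (γ : Measure (X × Y)) μ ν := by
  have tight : IsTightMeasureSet
      {((ρ : ProbabilityMeasure (X × Y)) : Measure (X × Y)) | ρ ∈ Set.range Γ} := by
    apply IsTightMeasureSet.prodMk
    · convert isTightMeasureSet_range_of_tendsto hμ using 1
      ext ρ
      simp [Measure.fst]
    · convert isTightMeasureSet_range_of_tendsto hν using 1
      ext ρ
      simp [Measure.snd]
  let U : Ultrafilter ℕ := Ultrafilter.of atTop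
  have hU : (U : Filter ℕ) ≤ atTop := Ultrafilter.of_le atTop
  obtain ⟨γ, -, hγ⟩ := (isCompact_closure_of_isTightMeasureSet tight).ultrafilter_le_nhds
    (U.map Γ) (le_principal_iff.2 <| Ultrafilter.mem_map.2 <|
      Filter.univ_mem' fun n => subset_closure (Set.mem_range_self n))
  have hγ' : Tendsto Γ U (𝓝 γ) := hγ
  refine ⟨U, γ, hU, hγ', ?_, ?_⟩
  · exact congrArg ProbabilityMeasure.toMeasure <| tendsto_nhds_unique
      (ProbabilityMeasure.tendsto_map_of_tendsto_of_continuous Γ γ hγ' continuous_fst)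
      (hμ.mono_left hU)
  · exact congrArg ProbabilityMeasure.toMeasure <| tendsto_nhds_unique
      (ProbabilityMeasure.tendsto_map_of_tendsto_of_continuous Γ γ hγ' continuous_snd)
      (hν.mono_left hU)

/-- Bounded convergence for a bounded continuous function evaluated along a pointwise convergent
sequence of measurable maps. -/
theorem tendsto_lintegral_comp_of_le {Ω X : Type*} [MeasurableSpace Ω] [TopologicalSpace X]
    [MeasurableSpace X] [OpensMeasurableSpace X] {π : Measure Ω} [IsFiniteMeasure π]
    {F : X → ℝ≥0∞} (hF : Continuous F) {C : ℝ≥0} (hC : ∀ x, F x ≤ C)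
    {s : ℕ → Ω → X} (hs : ∀ n, Measurable (s n)) {g : Ω → X}
    (hlim : ∀ ω, Tendsto (fun n => s n ω) atTop (𝓝 (g ω))) :
    Tendsto (fun n => ∫⁻ ω, F (s n ω) ∂π) atTop (𝓝 (∫⁻ ω, F (g ω) ∂π)) :=
  tendsto_lintegral_of_dominated_convergence (fun _ => C) (fun n => hF.measurable.comp (hs n))
    (fun _ => ae_of_all _ fun _ => hC _)
    (by simpa using ENNReal.mul_ne_top ENNReal.coe_ne_top (measure_ne_top π _))
    (ae_of_all _ fun ω => (hF.tendsto _).comp (hlim ω))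

/-- Averages of a Feller kernel along a pointwise convergent sequence of measurable maps converge
weakly. -/
theorem tendsto_probabilityMeasure_of_eq_bind {Ω X Y : Type*} [MeasurableSpace Ω]
    [TopologicalSpace X] [MeasurableSpace X] [OpensMeasurableSpace X]
    [TopologicalSpace Y] [MeasurableSpace Y] [OpensMeasurableSpace Y]
    {π : Measure Ω} [IsProbabilityMeasure π] {Q : Kernel X Y} [IsMarkovKernel Q]
    (hQ : ∀ f : Y →ᵇ ℝ, Continuous fun x => ∫ y, f y ∂(Q x))
    {s : ℕ → Ω → X} (hs : ∀ n, Measurable (s n)) {g : Ω → X} (hg : Measurable g)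
    (hlim : ∀ ω, Tendsto (fun n => s n ω) atTop (𝓝 (g ω)))
    {m : ℕ → ProbabilityMeasure Y} {l : ProbabilityMeasure Y}
    (hm : ∀ n, (m n : Measure Y) = π.bind fun ω => Q (s n ω))
    (hl : (l : Measure Y) = π.bind fun ω => Q (g ω)) :
    Tendsto m atTop (𝓝 l) := by
  let Q' : X → ProbabilityMeasure Y := fun x => ⟨Q x, inferInstance⟩
  have hQ' : Continuous Q' :=
    ProbabilityMeasure.continuous_iff_forall_continuous_integral.2 hQ
  rw [ProbabilityMeasure.tendsto_iff_forall_lintegral_tendsto]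
  intro f
  have hf : Measurable fun y => (f y : ℝ≥0∞) := by fun_prop
  have key : ∀ h : Ω → X, Measurable h →
      ∫⁻ y, f y ∂(π.bind fun ω => Q (h ω)) = ∫⁻ ω, ∫⁻ y, f y ∂(Q (h ω)) ∂π := fun h hh =>
    Measure.lintegral_bind (Q.measurable.comp hh).aemeasurable hf.aemeasurable
  simp only [hm, hl, key _ hg, key _ (hs _)]
  refine tendsto_lintegral_comp_of_le (F := fun x => ∫⁻ y, f y ∂(Q x)) (C := nndist f 0)
    (ProbabilityMeasure.continuous_iff_forall_continuous_lintegral.1 hQ' f) (fun x => ?_) hs hlim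
  calc ∫⁻ y, f y ∂(Q x) ≤ ∫⁻ _, (nndist f 0 : ℝ≥0) ∂(Q x) :=
        lintegral_mono fun y =>
          ENNReal.coe_le_coe.2 (BoundedContinuousFunction.NNReal.upper_bound f y)
    _ = _ := by simp

/-- If a Feller kernel does not expand the continuous bounded distance `d`, then applying it to
the marginals of `π` gives measures whose lifted distance is at most the cost of `π`. -/
theorem liftDist_bind_le_lintegral {X : Type*} [TopologicalSpace X] [PolishSpace X]
    [MeasurableSpace X] [BorelSpace X] {Q : Kernel X X} [IsMarkovKernel Q]
    (hFeller : ∀ f : X →ᵇ ℝ, Continuous fun x => ∫ y, f y ∂(Q x))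
    {d : X → X → ℝ} (hd_cont : Continuous fun p : X × X => d p.1 p.2)
    (hd_nonneg : ∀ x y, 0 ≤ d x y) (hd_le_one : ∀ x y, d x y ≤ 1)
    (hQ : ∀ x y, liftDist d (Q x) (Q y) ≤ ENNReal.ofReal (d x y))
    (π : Measure (X × X)) [IsProbabilityMeasure π] :
    liftDist d (π.bind fun p => Q p.1) (π.bind fun p => Q p.2) ≤
      ∫⁻ p, ENNReal.ofReal (d p.1 p.2) ∂π := by
  let := TopologicalSpace.upgradeIsCompletelyMetrizable X
  have hD_cont : Continuous fun p : X × X => ENNReal.ofReal (d p.1 p.2) :=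
    ENNReal.continuous_ofReal.comp hd_cont
  have hD_le : ∀ p : X × X, ENNReal.ofReal (d p.1 p.2) ≤ (1 : ℝ≥0) := fun p => by
    simpa using hd_le_one p.1 p.2
  refine ENNReal.le_of_forall_pos_le_add fun ε hε _ => ?_
  have hκ : ∀ p : X × X, ∃ κ : Measure (X × X), IsCoupling κ (Q p.1) (Q p.2) ∧
      ∫⁻ q, ENNReal.ofReal (d q.1 q.2) ∂κ ≤ ENNReal.ofReal (d p.1 p.2) + ε := fun p => by
    have hlt : liftDist d (Q p.1) (Q p.2) < ENNReal.ofReal (d p.1 p.2) + ε :=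
      (hQ p.1 p.2).trans_lt
        (ENNReal.lt_add_right ENNReal.ofReal_ne_top (ENNReal.coe_ne_zero.2 hε.ne'))
    obtain ⟨_, ⟨κ, hκ, rfl⟩, hlt⟩ := sInf_lt_iff.1 hlt
    exact ⟨κ, hκ, hlt.le⟩
  choose κ hκ_coupling hκ_cost using hκ
  have hκ_prob : ∀ p, IsProbabilityMeasure (κ p) := fun p =>
    (hκ_coupling p).isProbabilityMeasure
  obtain ⟨p₀⟩ : Nonempty (X × X) := nonempty_of_isProbabilityMeasure π
  let s : ℕ → SimpleFunc (X × X) (X × X) :=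
    SimpleFunc.approxOn id measurable_id Set.univ p₀ (Set.mem_univ _)
  have hs_lim : ∀ p, Tendsto (fun n => s n p) atTop (𝓝 p) := fun p =>
    SimpleFunc.tendsto_approxOn measurable_id (Set.mem_univ _) (by simp)
  have hκs : ∀ n, Measurable fun p => κ (s n p) := fun n => ((s n).map κ).measurable
  let Γ : ℕ → ProbabilityMeasure (X × X) := fun n =>
    ⟨π.bind fun p => κ (s n p),
      isProbabilityMeasure_bind (hκs n).aemeasurable (ae_of_all _ fun _ => hκ_prob _)⟩
  have hQ_fst : Measurable fun p : X × X => Q p.1 := Q.measurable.comp measurable_fst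
  have hQ_snd : Measurable fun p : X × X => Q p.2 := Q.measurable.comp measurable_snd
  let μ : ProbabilityMeasure X := ⟨π.bind fun p => Q p.1,
    isProbabilityMeasure_bind hQ_fst.aemeasurable (ae_of_all _ fun _ => inferInstance)⟩
  let ν : ProbabilityMeasure X := ⟨π.bind fun p => Q p.2,
    isProbabilityMeasure_bind hQ_snd.aemeasurable (ae_of_all _ fun _ => inferInstance)⟩
  have hmap : ∀ (n : ℕ) (f : X × X → X), Measurable f →
      (π.bind fun p => κ (s n p)).map f = π.bind fun p => (κ (s n p)).map f := fun n f hf => by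
    have hκf : Measurable fun p => (κ (s n p)).map f :=
      (Measure.measurable_map f hf).comp (hκs n)
    ext t ht
    rw [Measure.map_apply hf ht, Measure.bind_apply (hf ht) (hκs n).aemeasurable,
      Measure.bind_apply ht hκf.aemeasurable]
    simp only [Measure.map_apply hf ht]
  have hμ : Tendsto (fun n => (Γ n).map continuous_fst.measurable.aemeasurable) atTop (𝓝 μ) :=
    tendsto_probabilityMeasure_of_eq_bind hFeller (π := π) (s := fun n p => (s n p).1)
      (fun n => measurable_fst.comp (s n).measurable) measurable_fst
      (fun p => (continuous_fst.tendsto p).comp (hs_lim p))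
      (fun n => (hmap n _ measurable_fst).trans <| by simp only [(hκ_coupling _).1]) rfl
  have hν : Tendsto (fun n => (Γ n).map continuous_snd.measurable.aemeasurable) atTop (𝓝 ν) :=
    tendsto_probabilityMeasure_of_eq_bind hFeller (π := π) (s := fun n p => (s n p).2)
      (fun n => measurable_snd.comp (s n).measurable) measurable_snd
      (fun p => (continuous_snd.tendsto p).comp (hs_lim p))
      (fun n => (hmap n _ measurable_snd).trans <| by simp only [(hκ_coupling _).2]) rfl
  obtain ⟨U, γ, hU, hγ, hγ_coupling⟩ := exists_tendsto_ultrafilter_isCoupling hμ hν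
  let D : X × X →ᵇ ℝ≥0 :=
    BoundedContinuousFunction.mkOfBound
      ⟨fun p => (d p.1 p.2).toNNReal, continuous_real_toNNReal.comp hd_cont⟩ 1 fun p q => by
        simp only [ContinuousMap.coe_mk, NNReal.dist_eq, Real.coe_toNNReal _ (hd_nonneg _ _)]
        rw [abs_le]
        constructor <;> linarith [hd_nonneg p.1 p.2, hd_nonneg q.1 q.2, hd_le_one p.1 p.2,
          hd_le_one q.1 q.2]
  have hcost : Tendsto (fun n => ∫⁻ q, ENNReal.ofReal (d q.1 q.2) ∂(Γ n : Measure (X × X))) U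
      (𝓝 (∫⁻ q, ENNReal.ofReal (d q.1 q.2) ∂(γ : Measure (X × X)))) :=
    ProbabilityMeasure.tendsto_iff_forall_lintegral_tendsto.1 hγ D
  have hbound : Tendsto (fun n => ∫⁻ p, ENNReal.ofReal (d (s n p).1 (s n p).2) ∂π + ε) U
      (𝓝 (∫⁻ p, ENNReal.ofReal (d p.1 p.2) ∂π + ε)) :=
    ((tendsto_lintegral_comp_of_le hD_cont hD_le (fun n => (s n).measurable)
      hs_lim).add_const _).mono_left hU
  have hle : ∀ n, ∫⁻ q, ENNReal.ofReal (d q.1 q.2) ∂(Γ n : Measure (X × X)) ≤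
      ∫⁻ p, ENNReal.ofReal (d (s n p).1 (s n p).2) ∂π + ε := fun n =>
    calc ∫⁻ q, ENNReal.ofReal (d q.1 q.2) ∂(Γ n : Measure (X × X))
        = ∫⁻ p, ∫⁻ q, ENNReal.ofReal (d q.1 q.2) ∂(κ (s n p)) ∂π :=
          Measure.lintegral_bind (hκs n).aemeasurable hD_cont.measurable.aemeasurable
      _ ≤ ∫⁻ p, (ENNReal.ofReal (d (s n p).1 (s n p).2) + ε) ∂π :=
          lintegral_mono fun p => hκ_cost _
      _ = _ := by rw [lintegral_add_right _ measurable_const]; simp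
  exact hγ_coupling.liftDist_le.trans (le_of_tendsto_of_tendsto' hcost hbound hle)

/-- If `d` is contracting for `P` with constant `α < 1` and `Q` does not expand `d`, then
`d` is contracting for the composition (one step of `P` followed by one step of `Q`) with
the same constant `α`. -/
theorem stmt_12 {X : Type*} [TopologicalSpace X] [PolishSpace X]
    [MeasurableSpace X] [BorelSpace X]
    (P Q : Kernel X X) [IsMarkovKernel P] [IsMarkovKernel Q]
    (hFellerP : ∀ f : X →ᵇ ℝ, Continuous (fun x => ∫ y, f y ∂(P x)))
    (hFellerQ : ∀ f : X →ᵇ ℝ, Continuous (fun x => ∫ y, f y ∂(Q x)))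
    (d : X → X → ℝ)
    (hd_cont : Continuous (fun p : X × X => d p.1 p.2))
    (hd_symm : ∀ x y, d x y = d y x)
    (hd_eq_zero : ∀ x y, d x y = 0 ↔ x = y)
    (hd_nonneg : ∀ x y, 0 ≤ d x y) (hd_le_one : ∀ x y, d x y ≤ 1)
    (α : ℝ) (hα : α < 1)
    (hcontract : ∀ x y, d x y < 1 →
      liftDist d (P x) (P y) ≤ ENNReal.ofReal (α * d x y))
    (hQ : ∀ x y, d x y < 1 → liftDist d (Q x) (Q y) ≤ ENNReal.ofReal (d x y)) :
    ∀ x y, d x y < 1 →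
      liftDist d ((Q ∘ₖ P) x) ((Q ∘ₖ P) y) ≤ ENNReal.ofReal (α * d x y) := by
  have hQ' : ∀ x y, liftDist d (Q x) (Q y) ≤ ENNReal.ofReal (d x y) := fun x y => by
    rcases (hd_le_one x y).lt_or_eq with h | h
    · exact hQ x y h
    · have hprod : IsCoupling ((Q x).prod (Q y)) (Q x) (Q y) :=
        ⟨Measure.fst_prod, Measure.snd_prod⟩
      calc liftDist d (Q x) (Q y)
          ≤ ∫⁻ p, ENNReal.ofReal (d p.1 p.2) ∂((Q x).prod (Q y)) := hprod.liftDist_le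
        _ ≤ ∫⁻ _, 1 ∂((Q x).prod (Q y)) :=
            lintegral_mono fun p => ENNReal.ofReal_le_one.2 (hd_le_one _ _)
        _ = ENNReal.ofReal (d x y) := by simp [h]
  intro x y hxy
  refine le_trans (le_sInf ?_) (hcontract x y hxy)
  rintro _ ⟨π, ⟨hfst, hsnd⟩, rfl⟩
  have : IsProbabilityMeasure π := IsCoupling.isProbabilityMeasure ⟨hfst, hsnd⟩
  have hcomp : ∀ (z : X) (f : X × X → X), Measurable f → π.map f = P z →
      (Q ∘ₖ P) z = π.bind fun p => Q (f p) := fun z f hf hz => by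
    have hQf : Measurable fun p => Q (f p) := Q.measurable.comp hf
    ext t ht
    rw [Kernel.comp_apply' _ _ _ ht, ← hz, lintegral_map (Q.measurable_coe ht) hf,
      Measure.bind_apply ht hQf.aemeasurable]
  rw [hcomp x _ measurable_fst hfst, hcomp y _ measurable_snd hsnd]
  exact liftDist_bind_le_lintegral hFellerQ hd_cont hd_nonneg hd_le_one hQ' π
end
end

section
/- Let P and Q be Feller Markov kernels on a Polish space X and let d be a continuous, [0,1]-valued distance-like function on X×X. Suppose a set A ⊆ X is d-small for Q with constant ε > 0, and suppose the lifted distance satisfies d(P(x,·), P(y,·)) ≤ d(x,y) for all x, y with d(x,y) < 1. Then A is d-small, with the same constant ε, for the composition kernel R defined by R(x,·) = ∫ P(z,·) Q(x,dz) (one step of Q followed by one step of P): d(R(x,·), R(y,·)) ≤ 1 − ε for all x, y ∈ A. -/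
open MeasureTheory ProbabilityTheory Filter Topology BoundedContinuousFunction
open scoped ENNReal NNReal

noncomputable section

/-- Upper bounds on the costs of couplings pass to weak limits of the marginals, for a bounded
continuous cost. -/
theorem liftDist_le_of_tendsto {X : Type*} [TopologicalSpace X] [PolishSpace X]
    [MeasurableSpace X] [BorelSpace X] {d : X → X → ℝ}
    (hd_cont : Continuous (fun p : X × X => d p.1 p.2))
    (hd_nonneg : ∀ x y, 0 ≤ d x y) (hd_le_one : ∀ x y, d x y ≤ 1)
    {μs νs : ℕ → ProbabilityMeasure X} {μ ν : ProbabilityMeasure X}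
    (hμ : Tendsto μs atTop (𝓝 μ)) (hν : Tendsto νs atTop (𝓝 ν))
    (γ : ℕ → ProbabilityMeasure (X × X))
    (hγ : ∀ n, IsCoupling (γ n : Measure (X × X)) (μs n) (νs n))
    {c : ℕ → ℝ≥0∞} {C : ℝ≥0∞} (hc : Tendsto c atTop (𝓝 C))
    (hcost : ∀ n, ∫⁻ p, ENNReal.ofReal (d p.1 p.2) ∂(γ n : Measure (X × X)) ≤ c n) :
    liftDist d (μ : Measure X) ν ≤ C := by
  have tight_range {ρs : ℕ → ProbabilityMeasure X} {ρ : ProbabilityMeasure X}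
      (h : Tendsto ρs atTop (𝓝 ρ)) :
      IsTightMeasureSet {((ρ : ProbabilityMeasure X) : Measure X) | ρ ∈ Set.range ρs} := by
    let _ := TopologicalSpace.upgradeIsCompletelyMetrizable X
    exact isTightMeasureSet_of_isCompact_closure
      (h.isCompact_insert_range.closure_of_subset (Set.subset_insert _ _))
  have hT : IsTightMeasureSet
      {((ρ : ProbabilityMeasure (X × X)) : Measure (X × X)) | ρ ∈ Set.range γ} := by
    refine IsTightMeasureSet.prodMk ((tight_range hμ).subset ?_) ((tight_range hν).subset ?_)
    · rintro _ ⟨_, ⟨_, ⟨n, rfl⟩, rfl⟩, rfl⟩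
      exact ⟨μs n, ⟨n, rfl⟩, (hγ n).1.symm⟩
    · rintro _ ⟨_, ⟨_, ⟨n, rfl⟩, rfl⟩, rfl⟩
      exact ⟨νs n, ⟨n, rfl⟩, (hγ n).2.symm⟩
  have hK := isCompact_closure_of_isTightMeasureSet hT
  set U : Ultrafilter ℕ := Ultrafilter.of atTop
  have hU : (U : Filter ℕ) ≤ atTop := Ultrafilter.of_le _
  obtain ⟨π, -, hπ⟩ := hK.ultrafilter_le_nhds (U.map γ)
    (le_principal_iff.2 (Filter.mem_map.2 (Filter.univ_mem'
      fun n => subset_closure (Set.mem_range_self n))))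
  have hπ' : Tendsto γ U (𝓝 π) := hπ
  have h1 := ProbabilityMeasure.tendsto_map_of_tendsto_of_continuous _ _ hπ' continuous_fst
  have h2 := ProbabilityMeasure.tendsto_map_of_tendsto_of_continuous _ _ hπ' continuous_snd
  have e1 : π.map continuous_fst.measurable.aemeasurable = μ :=
    tendsto_nhds_unique h1 ((hμ.mono_left hU).congr fun n => Subtype.ext (hγ n).1.symm)
  have e2 : π.map continuous_snd.measurable.aemeasurable = ν :=
    tendsto_nhds_unique h2 ((hν.mono_left hU).congr fun n => Subtype.ext (hγ n).2.symm)
  let D : (X × X) →ᵇ ℝ≥0 := BoundedContinuousFunction.mkOfBound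
    ⟨fun p => (d p.1 p.2).toNNReal, continuous_real_toNNReal.comp hd_cont⟩ 1 (by
      intro p q
      simp only [ContinuousMap.coe_mk, NNReal.dist_eq, Real.coe_toNNReal _ (hd_nonneg _ _)]
      rw [abs_le]
      constructor <;> linarith [hd_nonneg p.1 p.2, hd_nonneg q.1 q.2, hd_le_one p.1 p.2,
        hd_le_one q.1 q.2])
  have hlim := ProbabilityMeasure.tendsto_iff_forall_lintegral_tendsto.1 hπ' D
  have hle : ∫⁻ p, D p ∂(π : Measure (X × X)) ≤ C :=
    le_of_tendsto_of_tendsto' hlim (hc.mono_left hU) hcost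
  exact sInf_le_of_le ⟨π, ⟨congrArg Subtype.val e1, congrArg Subtype.val e2⟩, rfl⟩ hle

/-- Near-optimal couplings of the images of points under a kernel that does not expand `d`. -/
theorem exists_isCoupling_lintegral_le {X : Type*} [MeasurableSpace X]
    (P : Kernel X X) [IsMarkovKernel P] {d : X → X → ℝ} (hd_le_one : ∀ x y, d x y ≤ 1)
    (hP : ∀ x y, d x y < 1 → liftDist d (P x) (P y) ≤ ENNReal.ofReal (d x y))
    {δ : ℝ≥0∞} (hδ : 0 < δ) (p : X × X) :
    ∃ π : Measure (X × X), IsCoupling π (P p.1) (P p.2) ∧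
      ∫⁻ q, ENNReal.ofReal (d q.1 q.2) ∂π ≤ ENNReal.ofReal (d p.1 p.2) + δ := by
  by_cases h : d p.1 p.2 < 1
  · obtain ⟨r, ⟨π, hπ, rfl⟩, hr⟩ := sInf_lt_iff.1
      ((hP _ _ h).trans_lt (ENNReal.lt_add_right ENNReal.ofReal_ne_top hδ.ne'))
    exact ⟨π, hπ, hr.le⟩
  · refine ⟨(P p.1).prod (P p.2), ⟨by simp, by simp⟩, ?_⟩
    have h1 : d p.1 p.2 = 1 := le_antisymm (hd_le_one _ _) (not_lt.1 h)
    calc ∫⁻ q, ENNReal.ofReal (d q.1 q.2) ∂((P p.1).prod (P p.2))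
        ≤ ∫⁻ _, 1 ∂((P p.1).prod (P p.2)) :=
          lintegral_mono fun q => ENNReal.ofReal_le_one.2 (hd_le_one _ _)
      _ ≤ _ := by simp [h1]

/-- If `g n → g'` pointwise and `P` is Feller, then the averages of `P (g n p)` over `p` converge
weakly to the average of `P (g' p)`. -/
theorem tendsto_comp_comap_of_feller {X Ω : Type*} [TopologicalSpace X] [PolishSpace X]
    [MeasurableSpace X] [BorelSpace X] [MeasurableSpace Ω]
    (P : Kernel X X) [IsMarkovKernel P]
    (hP : ∀ f : X →ᵇ ℝ, Continuous (fun x => ∫ y, f y ∂(P x)))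
    (π : Measure Ω) [IsProbabilityMeasure π] {g : ℕ → Ω → X} {g' : Ω → X}
    (hg : ∀ n, Measurable (g n)) (hg' : Measurable g')
    (hlim : ∀ p, Tendsto (fun n => g n p) atTop (𝓝 (g' p))) :
    Tendsto (β := ProbabilityMeasure X) (fun n => ⟨P.comap (g n) (hg n) ∘ₘ π, inferInstance⟩) atTop
      (𝓝 ⟨P.comap g' hg' ∘ₘ π, inferInstance⟩) := by
  refine ProbabilityMeasure.tendsto_iff_forall_integral_tendsto.2 fun f => ?_
  have key (h : Ω → X) (hh : Measurable h) :
      ∫ y, f y ∂(P.comap h hh ∘ₘ π) = ∫ p, ∫ y, f y ∂(P (h p)) ∂π :=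
    Kernel.integral_comp (η := P.comap h hh) (κ := Kernel.const Unit π) (a := ()) (f.integrable _)
  simp only [ProbabilityMeasure.coe_mk, key]
  refine tendsto_integral_of_dominated_convergence (fun _ => ‖f‖) (fun n => ?_)
    (integrable_const _) (fun n => ?_) ?_
  · exact ((hP f).measurable.comp (hg n)).aestronglyMeasurable
  · exact Eventually.of_forall fun p => f.norm_integral_le_norm _
  · exact Eventually.of_forall fun p => ((hP f).tendsto _).comp (hlim p)

/-- Every coupling of `Q x` and `Q y` bounds the lifted distance after one further step of a
Feller kernel that does not expand `d`. -/
theorem liftDist_comp_le_lintegral {X : Type*} [TopologicalSpace X] [PolishSpace X]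
    [MeasurableSpace X] [BorelSpace X]
    (P : Kernel X X) [IsMarkovKernel P]
    (hFeller : ∀ f : X →ᵇ ℝ, Continuous (fun x => ∫ y, f y ∂(P x)))
    {d : X → X → ℝ} (hd_cont : Continuous (fun p : X × X => d p.1 p.2))
    (hd_nonneg : ∀ x y, 0 ≤ d x y) (hd_le_one : ∀ x y, d x y ≤ 1)
    (hP : ∀ x y, d x y < 1 → liftDist d (P x) (P y) ≤ ENNReal.ofReal (d x y))
    {μ ν : Measure X} [IsProbabilityMeasure μ] {π : Measure (X × X)} (hπ : IsCoupling π μ ν) :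
    liftDist d (P ∘ₘ μ) (P ∘ₘ ν) ≤ ∫⁻ p, ENNReal.ofReal (d p.1 p.2) ∂π := by
  have : IsProbabilityMeasure π := by
    have : IsProbabilityMeasure (π.map Prod.fst) := by rw [hπ.1]; infer_instance
    exact Measure.isProbabilityMeasure_of_map Prod.fst
  let s : ℕ → SimpleFunc (X × X) (X × X) := (stronglyMeasurable_id (α := X × X)).approx
  have hs (p : X × X) : Tendsto (fun n => s n p) atTop (𝓝 p) :=
    stronglyMeasurable_id.tendsto_approx p
  have hδ (n : ℕ) : (0 : ℝ≥0∞) < (n : ℝ≥0∞)⁻¹ := ENNReal.inv_pos.2 (ENNReal.natCast_ne_top n)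
  choose K hK hKcost using fun n => exists_isCoupling_lintegral_le P hd_le_one hP (hδ n)
  let κ (n : ℕ) : Kernel (X × X) (X × X) := ⟨fun p => K n (s n p), ((s n).map (K n)).measurable⟩
  have hκ (n : ℕ) : IsMarkovKernel (κ n) := ⟨fun p => by
    have : IsProbabilityMeasure ((κ n p).map Prod.fst) := by
      rw [show (κ n p).map Prod.fst = P (s n p).1 from (hK n (s n p)).1]; infer_instance
    exact Measure.isProbabilityMeasure_of_map Prod.fst⟩
  have m1 (n : ℕ) : Measurable fun p => (s n p).1 := (s n).measurable.fst
  have m2 (n : ℕ) : Measurable fun p => (s n p).2 := (s n).measurable.snd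
  have e1 (n : ℕ) : (κ n).map Prod.fst = P.comap _ (m1 n) := by
    ext1 p
    rw [Kernel.map_apply _ measurable_fst]
    exact (hK n (s n p)).1
  have e2 (n : ℕ) : (κ n).map Prod.snd = P.comap _ (m2 n) := by
    ext1 p
    rw [Kernel.map_apply _ measurable_snd]
    exact (hK n (s n p)).2
  have l1 := tendsto_comp_comap_of_feller P hFeller π m1 measurable_fst
    fun p => (continuous_fst.tendsto p).comp (hs p)
  have l2 := tendsto_comp_comap_of_feller P hFeller π m2 measurable_snd
    fun p => (continuous_snd.tendsto p).comp (hs p)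
  have hcomp {f : X × X → X} (hf : Measurable f) : P.comap f hf ∘ₘ π = P ∘ₘ (π.map f) := by
    rw [← Kernel.comp_deterministic_eq_comap, ← Measure.comp_assoc,
      Measure.deterministic_comp_eq_map]
  have hcont : Continuous fun p : X × X => ENNReal.ofReal (d p.1 p.2) :=
    ENNReal.continuous_ofReal.comp hd_cont
  have lc : Tendsto (fun n : ℕ => ∫⁻ p, ENNReal.ofReal (d (s n p).1 (s n p).2) ∂π + (n : ℝ≥0∞)⁻¹)
      atTop (𝓝 (∫⁻ p, ENNReal.ofReal (d p.1 p.2) ∂π)) := by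
    rw [← add_zero (∫⁻ p, ENNReal.ofReal (d p.1 p.2) ∂π)]
    refine Tendsto.add ?_ ENNReal.tendsto_inv_nat_nhds_zero
    refine tendsto_lintegral_of_dominated_convergence (fun _ => 1)
      (fun n => hcont.measurable.comp (s n).measurable)
      (fun n => Eventually.of_forall fun p => ENNReal.ofReal_le_one.2 (hd_le_one _ _))
      (by simp) (Eventually.of_forall fun p => (hcont.tendsto p).comp (hs p))
  have main := liftDist_le_of_tendsto hd_cont hd_nonneg hd_le_one l1 l2
    (fun n => ⟨κ n ∘ₘ π, inferInstance⟩) (fun n => ⟨?_, ?_⟩) lc (fun n => ?_)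
  · simpa only [ProbabilityMeasure.coe_mk, hcomp, hπ.1, hπ.2] using main
  · simp only [ProbabilityMeasure.coe_mk]
    rw [Measure.map_comp _ _ measurable_fst, e1]
  · simp only [ProbabilityMeasure.coe_mk]
    rw [Measure.map_comp _ _ measurable_snd, e2]
  · simp only [ProbabilityMeasure.coe_mk]
    rw [Measure.lintegral_bind (κ n).aemeasurable hcont.measurable.aemeasurable]
    calc _ ≤ ∫⁻ p, (ENNReal.ofReal (d (s n p).1 (s n p).2) + (n : ℝ≥0∞)⁻¹) ∂π :=
          lintegral_mono fun p => hKcost n (s n p)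
      _ = _ := by rw [lintegral_add_right _ measurable_const]; simp

/-- If a set `A` is `d`-small for `Q` with constant `ε` and `P` does not expand `d`, then
`A` is `d`-small for the composition (one step of `Q` followed by one step of `P`) with the
same constant `ε`. -/
theorem stmt_13 {X : Type*} [TopologicalSpace X] [PolishSpace X]
    [MeasurableSpace X] [BorelSpace X]
    (P Q : Kernel X X) [IsMarkovKernel P] [IsMarkovKernel Q]
    (hFellerP : ∀ f : X →ᵇ ℝ, Continuous (fun x => ∫ y, f y ∂(P x)))
    (hFellerQ : ∀ f : X →ᵇ ℝ, Continuous (fun x => ∫ y, f y ∂(Q x)))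
    (d : X → X → ℝ)
    (hd_cont : Continuous (fun p : X × X => d p.1 p.2))
    (hd_symm : ∀ x y, d x y = d y x)
    (hd_eq_zero : ∀ x y, d x y = 0 ↔ x = y)
    (hd_nonneg : ∀ x y, 0 ≤ d x y) (hd_le_one : ∀ x y, d x y ≤ 1)
    (A : Set X) (ε : ℝ) (hε : 0 < ε)
    (hsmall : ∀ x ∈ A, ∀ y ∈ A, liftDist d (Q x) (Q y) ≤ ENNReal.ofReal (1 - ε))
    (hP : ∀ x y, d x y < 1 → liftDist d (P x) (P y) ≤ ENNReal.ofReal (d x y)) :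
    ∀ x ∈ A, ∀ y ∈ A,
      liftDist d ((P ∘ₖ Q) x) ((P ∘ₖ Q) y) ≤ ENNReal.ofReal (1 - ε) := by
  intro x hx y hy
  refine le_trans (le_sInf ?_) (hsmall x hx y hy)
  rintro _ ⟨π, hπ, rfl⟩
  rw [Kernel.comp_apply, Kernel.comp_apply]
  exact liftDist_comp_le_lintegral P hFellerP hd_cont hd_nonneg hd_le_one hP hπ
end
end

section
/- Let X be a Polish space and d: X×X → [0,∞) a distance-like function (symmetric, lower semicontinuous, and d(x,y) = 0 if and only if x = y). Then for any Borel probability measures μ, ν on X: (a) the infimum defining the lifted distance d(μ,ν) = inf_{π ∈ C(μ,ν)} ∫ d dπ is attained by some coupling π ∈ C(μ,ν); (b) d(μ,ν) ≥ 0 and d(μ,ν) = 0 if and only if μ = ν. -/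
open MeasureTheory ProbabilityTheory Filter Topology
open scoped ENNReal NNReal

noncomputable section

/-- Integration of a nonnegative lower semicontinuous function is lower semicontinuous with respect
to weak convergence of probability measures. -/
lemma lowerSemicontinuous_lintegral_ofReal {Y : Type*} [TopologicalSpace Y]
    [TopologicalSpace.PseudoMetrizableSpace Y] [TopologicalSpace.SeparableSpace Y]
    [MeasurableSpace Y] [OpensMeasurableSpace Y]
    {f : Y → ℝ} (hf : LowerSemicontinuous f) (hf_nonneg : 0 ≤ f) :
    LowerSemicontinuous
      (fun π : ProbabilityMeasure Y => ∫⁻ y, ENNReal.ofReal (f y) ∂(π : Measure Y)) := by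
  intro π₀
  refine lowerSemicontinuousAt_iff_le_liminf.2 ?_
  simp_rw [lintegral_eq_lintegral_meas_lt _ (Eventually.of_forall hf_nonneg)
    hf.measurable.aemeasurable]
  calc ∫⁻ t in Set.Ioi (0 : ℝ), (π₀ : Measure Y) {a | t < f a}
      ≤ ∫⁻ t in Set.Ioi (0 : ℝ),
          liminf (fun π : ProbabilityMeasure Y => (π : Measure Y) {a | t < f a}) (𝓝 π₀) :=
        lintegral_mono fun t => ProbabilityMeasure.le_liminf_measure_open_of_tendsto
          tendsto_id (hf.isOpen_preimage t)
    _ ≤ liminf (fun π : ProbabilityMeasure Y =>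
          ∫⁻ t in Set.Ioi (0 : ℝ), (π : Measure Y) {a | t < f a}) (𝓝 π₀) :=
        lintegral_liminf_le fun π => Antitone.measurable
          fun _ _ hst => measure_mono fun _ ha => lt_of_le_of_lt hst ha

/-- The set of couplings of two probability measures on Polish spaces is weakly compact. -/
lemma isCompact_setOf_isCoupling {X Y : Type*}
    [TopologicalSpace X] [PolishSpace X] [MeasurableSpace X] [BorelSpace X]
    [TopologicalSpace Y] [PolishSpace Y] [MeasurableSpace Y] [BorelSpace Y]
    (μ : Measure X) (ν : Measure Y) [IsProbabilityMeasure μ] [IsProbabilityMeasure ν] :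
    IsCompact {π : ProbabilityMeasure (X × Y) | IsCoupling (π : Measure (X × Y)) μ ν} := by
  set S := {π : ProbabilityMeasure (X × Y) | IsCoupling (π : Measure (X × Y)) μ ν}
  have hclosed : IsClosed S := by
    have hS : S = (fun π : ProbabilityMeasure (X × Y) =>
          π.map (continuous_fst (X := X) (Y := Y)).measurable.aemeasurable) ⁻¹' {⟨μ, ‹_›⟩} ∩
        (fun π : ProbabilityMeasure (X × Y) =>
          π.map (continuous_snd (X := X) (Y := Y)).measurable.aemeasurable) ⁻¹' {⟨ν, ‹_›⟩} := by
      ext π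
      exact ⟨fun h => ⟨Subtype.ext h.1, Subtype.ext h.2⟩,
        fun h => ⟨congrArg Subtype.val h.1, congrArg Subtype.val h.2⟩⟩
    rw [hS]
    exact (isClosed_singleton.preimage (ProbabilityMeasure.continuous_map continuous_fst)).inter
      (isClosed_singleton.preimage (ProbabilityMeasure.continuous_map continuous_snd))
  rw [← hclosed.closure_eq]
  refine isCompact_closure_of_isTightMeasureSet (IsTightMeasureSet.prodMk
    ((isTightMeasureSet_singleton (μ := μ)).subset ?_)
    ((isTightMeasureSet_singleton (μ := ν)).subset ?_))
  · rintro _ ⟨_, ⟨π, hπ, rfl⟩, rfl⟩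
    exact hπ.1
  · rintro _ ⟨_, ⟨π, hπ, rfl⟩, rfl⟩
    exact hπ.2

/-- An optimal coupling exists for every nonnegative lower semicontinuous cost. -/
lemma exists_isCoupling_lintegral_eq_liftDist {X : Type*} [TopologicalSpace X] [PolishSpace X]
    [MeasurableSpace X] [BorelSpace X] {d : X → X → ℝ}
    (hd_lsc : LowerSemicontinuous (fun p : X × X => d p.1 p.2))
    (hd_nonneg : ∀ x y, 0 ≤ d x y)
    (μ ν : Measure X) [IsProbabilityMeasure μ] [IsProbabilityMeasure ν] :
    ∃ π : Measure (X × X), IsCoupling π μ ν ∧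
      (∫⁻ p, ENNReal.ofReal (d p.1 p.2) ∂π) = liftDist d μ ν := by
  have hne : {π : ProbabilityMeasure (X × X) | IsCoupling (π : Measure (X × X)) μ ν}.Nonempty :=
    ⟨⟨μ.prod ν, inferInstance⟩, Measure.fst_prod, Measure.snd_prod⟩
  obtain ⟨π, hπ, hmin⟩ := LowerSemicontinuousOn.exists_isMinOn hne
    (isCompact_setOf_isCoupling μ ν)
    ((lowerSemicontinuous_lintegral_ofReal hd_lsc fun p => hd_nonneg p.1 p.2).lowerSemicontinuousOn
      _)
  refine ⟨π, hπ, le_antisymm (le_sInf ?_) (sInf_le ⟨π, hπ, rfl⟩)⟩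
  rintro _ ⟨π', hπ', rfl⟩
  have : IsProbabilityMeasure π' := ⟨by
    rw [← Set.preimage_univ (f := Prod.fst), ← Measure.map_apply measurable_fst MeasurableSet.univ,
      hπ'.1, measure_univ]⟩
  exact hmin (a := ⟨π', this⟩) hπ'

/-- For a distance-like function `d` on a Polish space: (a) the infimum in the definition
of the lifted distance is attained by some coupling; (b) the lifted distance is nonnegative
and vanishes exactly when the two probability measures coincide. -/
theorem stmt_16 {X : Type*} [TopologicalSpace X] [PolishSpace X]
    [MeasurableSpace X] [BorelSpace X]
    (d : X → X → ℝ)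
    (hd_symm : ∀ x y, d x y = d y x)
    (hd_eq_zero : ∀ x y, d x y = 0 ↔ x = y)
    (hd_lsc : LowerSemicontinuous (fun p : X × X => d p.1 p.2))
    (hd_nonneg : ∀ x y, 0 ≤ d x y)
    (μ ν : Measure X) [IsProbabilityMeasure μ] [IsProbabilityMeasure ν] :
    (∃ π : Measure (X × X), IsCoupling π μ ν ∧
      (∫⁻ p, ENNReal.ofReal (d p.1 p.2) ∂π) = liftDist d μ ν) ∧
    (0 ≤ liftDist d μ ν) ∧
    (liftDist d μ ν = 0 ↔ μ = ν) := by
  have hopt := exists_isCoupling_lintegral_eq_liftDist hd_lsc hd_nonneg μ ν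
  refine ⟨hopt, zero_le, fun h => ?_, ?_⟩
  · obtain ⟨π, hπ, hint⟩ := hopt
    rw [h, lintegral_eq_zero_iff hd_lsc.measurable.ennreal_ofReal] at hint
    rw [← hπ.1, ← hπ.2]
    refine Measure.map_congr ?_
    filter_upwards [hint] with p hp
    exact (hd_eq_zero _ _).1 (le_antisymm (ENNReal.ofReal_eq_zero.1 hp) (hd_nonneg _ _))
  · rintro rfl
    have hdiag : Measurable fun x : X => (x, x) := measurable_id.prodMk measurable_id
    refine le_antisymm (sInf_le ⟨μ.map fun x => (x, x), ⟨?_, ?_⟩, ?_⟩) zero_le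
    · rw [Measure.map_map measurable_fst hdiag]
      exact Measure.map_id
    · rw [Measure.map_map measurable_snd hdiag]
      exact Measure.map_id
    · rw [lintegral_map hd_lsc.measurable.ennreal_ofReal hdiag]
      simp [(hd_eq_zero _ _).2 rfl]
end
end
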